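/- Let q ≥ 2 be a fixed even integer and t ≥ 1 a fixed integer. For every real ε > 0 there exist a constant γ (depending only on t, q and ε) and an integer n₀ such that for all n ≥ n₀ there exist a positive integer m with m ≤ log₂ n + (8+ε)·(log₂ q + 1)·log₂ log₂ n + γ and a function f : Z_q^n → {0,1}^m with the following property: for all x, x' ∈ Z_q^n whose least-significant-bit strings (x₁ mod 2, …, x_n mod 2) and (x'₁ mod 2, …, x'_n mod 2) are both (0^t1^t, t·2^{t+1}·⌈log₂ n⌉)-dense, if f(x) = f(x') and B_{≤t}(x) ∩ B_{≤t}(x') ≠ ∅, then x = x'. -/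

import Mathlib

/-- `Bset t x` : strings obtained from `x` by deleting a burst of at most `t`
consecutive symbols. -/
def Bset {α : Type*} (t : ℕ) (x : List α) : Set (List α) :=
  {y | ∃ u v w : List α, x = u ++ v ++ w ∧ y = u ++ w ∧ v.length ≤ t}

/-- A binary string `c` is `(p, δ)`-dense if every substring of `c` of length `δ`
contains `p` as a substring. -/
def DenseStr (p : List Bool) (δ : ℕ) (c : List Bool) : Prop :=
  ∀ v : List Bool, v.IsInfix c → v.length = δ → p.IsInfix v

/-- The pattern `0^t 1^t`. -/
def pat (t : ℕ) : List Bool := List.replicate t false ++ List.replicate t true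

/-- The least-significant-bit string of a `q`-ary string. -/
def lsb {q : ℕ} (x : List (Fin q)) : List Bool :=
  x.map (fun a => decide (a.val % 2 = 1))

section Coloring

/-- A finite symmetric relation whose neighbourhoods have at most `d` elements has a proper
colouring with `d + 1` colours. -/
theorem exists_proper_coloring {V : Type*} [Fintype V] (r : V → V → Prop)
    (hsymm : ∀ v w, r v w → r w v) (d : ℕ)
    (hd : ∀ v, ∃ s : Finset V, s.card ≤ d ∧ ∀ w, r v w → w ∈ s) :
    ∃ c : V → ZMod (d + 1), ∀ v w, r v w → c v = c w → v = w := by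
  classical
  suffices h : ∀ A : Finset V, ∃ c : V → ZMod (d + 1),
      ∀ v ∈ A, ∀ w ∈ A, r v w → c v = c w → v = w by
    obtain ⟨c, hc⟩ := h Finset.univ
    exact ⟨c, fun v w => hc v (Finset.mem_univ _) w (Finset.mem_univ _)⟩
  intro A
  induction A using Finset.induction_on with
  | empty => exact ⟨fun _ => 0, by simp⟩
  | insert v A hv ih =>
    obtain ⟨c, hc⟩ := ih
    obtain ⟨s, hs, hsr⟩ := hd v
    have hlt : (s.image c).card < (Finset.univ : Finset (ZMod (d + 1))).card := by
      rw [Finset.card_univ, ZMod.card]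
      exact Nat.lt_succ_of_le (Finset.card_image_le.trans hs)
    obtain ⟨e, -, he⟩ := Finset.exists_mem_notMem_of_card_lt_card hlt
    have hne : ∀ w, r v w → c w ≠ e := fun w hw h =>
      he (h ▸ Finset.mem_image_of_mem c (hsr w hw))
    refine ⟨Function.update c v e, fun x hx y hy hxy hxy' => ?_⟩
    by_cases hxv : x = v
    · by_cases hyv : y = v
      · rw [hxv, hyv]
      · subst hxv
        rw [Function.update_self, Function.update_of_ne hyv] at hxy'
        exact absurd hxy'.symm (hne y hxy)
    · by_cases hyv : y = v
      · subst hyv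
        rw [Function.update_self, Function.update_of_ne hxv] at hxy'
        exact absurd hxy' (hne x (hsymm _ _ hxy))
      · rw [Function.update_of_ne hxv, Function.update_of_ne hyv] at hxy'
        exact hc x (Finset.mem_of_mem_insert_of_ne hx hxv) y
          (Finset.mem_of_mem_insert_of_ne hy hyv) hxy hxy'

end Coloring

section Shift

/-- `Y'` arises from `Y` by deleting `k` symbols at position `a` and inserting `k` symbols
at position `a + L`. -/
structure BurstShift {α : Type*} (Y Y' : ℕ → α) (a L k : ℕ) : Prop where
  before : ∀ i < a, Y i = Y' i
  shift : ∀ i, a ≤ i → i < a + L → Y (i + k) = Y' i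
  after : ∀ i, a + L + k ≤ i → Y i = Y' i

theorem BurstShift.comp {α β : Type*} {Y Y' : ℕ → α} {a L k : ℕ} (h : BurstShift Y Y' a L k)
    (g : α → β) : BurstShift (fun i => g (Y i)) (fun i => g (Y' i)) a L k :=
  ⟨fun i hi => congrArg g (h.before i hi), fun i hi hi' => congrArg g (h.shift i hi hi'),
    fun i hi => congrArg g (h.after i hi)⟩

/-- The block of length `M` of `X` starting at position `s`. -/
def block {α : Type*} (M s : ℕ) (X : ℕ → α) : Fin M → α := fun i => X (s + i)

/-- Extension of a finite word to an infinite one by a padding symbol. -/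
def padWord {α : Type*} (z : α) {M : ℕ} (y : Fin M → α) : ℕ → α :=
  fun i => if h : i < M then y ⟨i, h⟩ else z

theorem BurstShift.block {α : Type*} (z : α) {X X' : ℕ → α} {a L k M s : ℕ}
    (h : BurstShift X X' a L k) (hs : s ≤ a) (hM : a + L + k ≤ s + M) :
    BurstShift (padWord z (block M s X)) (padWord z (block M s X')) (a - s) L k := by
  obtain ⟨h1, h2, h3⟩ := h
  refine ⟨fun i hi => ?_, fun i hi hi' => ?_, fun i hi => ?_⟩
  · simp only [padWord, _root_.block]
    split_ifs
    · exact h1 _ (by omega)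
    · rfl
  · simp only [padWord, _root_.block]
    rw [dif_pos (by omega), dif_pos (by omega), ← h2 _ (by omega) (by omega)]
    congr 1
    omega
  · simp only [padWord, _root_.block]
    split_ifs
    · exact h3 _ (by omega)
    · rfl

theorem exists_burst_coloring {α : Type*} [Fintype α] (z : α) (t M : ℕ) :
    ∃ N : ℕ, N = 2 * ((M + 1) * (M + 1) * (t + 1) * Fintype.card α ^ t) + 1 ∧
      ∃ c : (Fin M → α) → ZMod N, ∀ y y' : Fin M → α, (∃ a L k, a + L + k ≤ M ∧ k ≤ t ∧
        BurstShift (padWord z y) (padWord z y') a L k) → c y = c y' → y = y' := by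
  classical
  let r : (Fin M → α) → (Fin M → α) → Prop := fun y y' => ∃ a L k, a + L + k ≤ M ∧ k ≤ t ∧
        BurstShift (padWord z y) (padWord z y') a L k
  let P := Fin (M + 1) × Fin (M + 1) × Fin (t + 1) × (Fin t → α)
  let g₁ : (Fin M → α) → P → (Fin M → α) := fun y p i =>
    if (i : ℕ) < p.1 then y i else if (i : ℕ) < p.1 + p.2.1 then padWord z y (i + p.2.2.1)
    else if (i : ℕ) < p.1 + p.2.1 + p.2.2.1 then padWord z p.2.2.2 (i - p.1 - p.2.1) else y i
  let g₂ : (Fin M → α) → P → (Fin M → α) := fun y p i =>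
    if (i : ℕ) < p.1 then y i else if (i : ℕ) < p.1 + p.2.2.1 then padWord z p.2.2.2 (i - p.1)
    else if (i : ℕ) < p.1 + p.2.1 + p.2.2.1 then padWord z y (i - p.2.2.1) else y i
  have hP : (Finset.univ : Finset P).card = (M + 1) * (M + 1) * (t + 1) * Fintype.card α ^ t := by
    simp only [P, Finset.card_univ, Fintype.card_prod, Fintype.card_fin, Fintype.card_fun]
    ring
  have hpad : ∀ (y : Fin M → α) (i : Fin M), padWord z y i = y i := fun y i => by
    simp [padWord]
  have h₁ : ∀ y y', r y y' → y' ∈ Finset.univ.image (g₁ y) := by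
    rintro y y' ⟨a, L, k, hM, hk, h⟩
    refine Finset.mem_image.2 ⟨(⟨a, by omega⟩, ⟨L, by omega⟩, ⟨k, by omega⟩,
      fun i => padWord z y' (a + L + i)), Finset.mem_univ _, funext fun i => ?_⟩
    simp only [g₁]
    split_ifs with c1 c2 c3
    · rw [← hpad y, ← hpad y', h.before _ c1]
    · rw [← hpad y', h.shift _ (by omega) c2]
    · rw [← hpad y', padWord, dif_pos (by omega)]
      congr 1
      dsimp only
      omega
    · rw [← hpad y, ← hpad y', h.after _ (by omega)]
  have h₂ : ∀ y y', r y' y → y' ∈ Finset.univ.image (g₂ y) := by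
    rintro y y' ⟨a, L, k, hM, hk, h⟩
    refine Finset.mem_image.2 ⟨(⟨a, by omega⟩, ⟨L, by omega⟩, ⟨k, by omega⟩,
      fun i => padWord z y' (a + i)), Finset.mem_univ _, funext fun i => ?_⟩
    simp only [g₂]
    split_ifs with c1 c2 c3
    · rw [← hpad y, ← hpad y', h.before _ c1]
    · rw [← hpad y', padWord, dif_pos (by omega)]
      congr 1
      dsimp only
      omega
    · rw [← hpad y', ← h.shift _ (by omega) (by omega)]
      congr 1
      omega
    · rw [← hpad y, ← hpad y', h.after _ (by omega)]
  obtain ⟨c, hc⟩ := exists_proper_coloring (fun y y' => r y y' ∨ r y' y) (fun _ _ h => h.symm)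
    (2 * ((M + 1) * (M + 1) * (t + 1) * Fintype.card α ^ t))
    (fun y => ⟨Finset.univ.image (g₁ y) ∪ Finset.univ.image (g₂ y), by
      refine (Finset.card_union_le _ _).trans ?_
      rw [← hP, two_mul]
      exact add_le_add Finset.card_image_le Finset.card_image_le, fun y' h => by
      rcases h with h | h
      · exact Finset.mem_union_left _ (h₁ _ _ h)
      · exact Finset.mem_union_right _ (h₂ _ _ h)⟩)
  exact ⟨_, rfl, c, fun y y' h => hc y y' (Or.inl h)⟩

/-- Summing a colouring of blocks of length `2 * R` over the two tilings with offsets `0` and `R`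
determines a word up to burst shifts inside a window of length at most `R`. -/
theorem BurstShift.eq_of_block_sums {α A : Type*} [AddCommGroup A] (z : α) {X X' : ℕ → α}
    {a L k R n t : ℕ} (h : BurstShift X X' a L k) (hR : L + k ≤ R) (hR0 : 0 < R) (hk : k ≤ t)
    (han : a ≤ n) (c : (Fin (2 * R) → α) → A)
    (hc : ∀ y y' : Fin (2 * R) → α, (∃ a L k, a + L + k ≤ 2 * R ∧ k ≤ t ∧
      BurstShift (padWord z y) (padWord z y') a L k) → c y = c y' → y = y')
    (h0 : ∑ i ∈ Finset.range (n + 1), c (_root_.block (2 * R) (i * (2 * R)) X) =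
      ∑ i ∈ Finset.range (n + 1), c (_root_.block (2 * R) (i * (2 * R)) X'))
    (h1 : ∑ i ∈ Finset.range (n + 1), c (_root_.block (2 * R) (i * (2 * R) + R) X) =
      ∑ i ∈ Finset.range (n + 1), c (_root_.block (2 * R) (i * (2 * R) + R) X')) :
    X = X' := by
  have key : ∀ o, a / (2 * R) * (2 * R) + o ≤ a →
      a + L + k ≤ a / (2 * R) * (2 * R) + o + 2 * R →
      ∑ i ∈ Finset.range (n + 1), c (_root_.block (2 * R) (i * (2 * R) + o) X) =
        ∑ i ∈ Finset.range (n + 1), c (_root_.block (2 * R) (i * (2 * R) + o) X') → X = X' := by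
    intro o ho1 ho2 hsum
    set κ := a / (2 * R) with hκ
    have hmem : κ ∈ Finset.range (n + 1) :=
      Finset.mem_range.2 (Nat.lt_succ_of_le ((Nat.div_le_self _ _).trans han))
    have hrest : ∑ i ∈ (Finset.range (n + 1)).erase κ,
        c (_root_.block (2 * R) (i * (2 * R) + o) X) = ∑ i ∈ (Finset.range (n + 1)).erase κ,
        c (_root_.block (2 * R) (i * (2 * R) + o) X') := by
      refine Finset.sum_congr rfl fun i hi => congrArg c (funext fun j => ?_)
      have hne := Finset.ne_of_mem_erase hi
      have hj := j.2
      simp only [_root_.block]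
      rcases lt_or_gt_of_ne hne with hlt | hgt
      · have : (i + 1) * (2 * R) ≤ κ * (2 * R) := Nat.mul_le_mul_right _ hlt
        rw [Nat.add_mul] at this
        exact h.before _ (by omega)
      · have : (κ + 1) * (2 * R) ≤ i * (2 * R) := Nat.mul_le_mul_right _ hgt
        rw [Nat.add_mul] at this
        exact h.after _ (by omega)
    rw [← Finset.add_sum_erase _ _ hmem, ← Finset.add_sum_erase _ _ hmem, hrest] at hsum
    have hb := hc _ _ ⟨_, _, _, by omega, hk, h.block z ho1 ho2⟩ (add_right_cancel hsum)
    funext i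
    by_cases hi1 : i < a
    · exact h.before i hi1
    · by_cases hi2 : a + L + k ≤ i
      · exact h.after i hi2
      · have := congrFun hb ⟨i - (κ * (2 * R) + o), by omega⟩
        simp only [_root_.block] at this
        rwa [Nat.add_sub_cancel' (by omega)] at this
  have hdm := Nat.div_add_mod' a (2 * R)
  have hlt := Nat.mod_lt a (show 2 * R > 0 by omega)
  by_cases hr : a % (2 * R) ≤ R
  · exact key 0 (by omega) (by omega) (by simpa using h0)
  · exact key R (by omega) (by omega) h1

end Shift

section Marker

/-- The pattern `0^t 1^t` occurs in `b` at position `j`. -/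
def MarkerAt (t : ℕ) (b : ℕ → Bool) (j : ℕ) : Prop :=
  ∀ i < t, b (j + i) = false ∧ b (j + t + i) = true

open Classical in
/-- The indicator of the occurrences of `0^t 1^t`. -/
noncomputable def markInd (t : ℕ) (b : ℕ → Bool) (j : ℕ) : ℤ := if MarkerAt t b j then 1 else 0

/-- The number of occurrences of `0^t 1^t` starting before position `j`. -/
noncomputable def markCount (t : ℕ) (b : ℕ → Bool) (j : ℕ) : ℤ :=
  ∑ i ∈ Finset.range j, markInd t b i

theorem MarkerAt.add_le {t : ℕ} {b : ℕ → Bool} {i j : ℕ} (ht : 1 ≤ t) (hi : MarkerAt t b i)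
    (hj : MarkerAt t b j) (hij : i < j) : i + 2 * t ≤ j := by
  by_contra hlt
  by_cases h : j < i + t
  · have h1 := (hi (j - i - 1) (by omega)).2
    have h2 := (hj (t - 1) (by omega)).1
    rw [show i + t + (j - i - 1) = j + (t - 1) by omega, h2] at h1
    cases h1
  · have h1 := (hi (j - i - t) (by omega)).2
    have h2 := (hj 0 (by omega)).1
    rw [show i + t + (j - i - t) = j + 0 by omega, h2] at h1
    cases h1

theorem markInd_nonneg (t : ℕ) (b : ℕ → Bool) (j : ℕ) : 0 ≤ markInd t b j := by
  unfold markInd; split_ifs <;> norm_num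

theorem markInd_le_one (t : ℕ) (b : ℕ → Bool) (j : ℕ) : markInd t b j ≤ 1 := by
  unfold markInd; split_ifs <;> norm_num

theorem markInd_congr {t : ℕ} {b b' : ℕ → Bool} {j j' : ℕ}
    (h : ∀ i < 2 * t, b (j + i) = b' (j' + i)) : markInd t b j = markInd t b' j' := by
  have : MarkerAt t b j ↔ MarkerAt t b' j' := by
    refine forall₂_congr fun i hi => ?_
    rw [h i (by omega), add_assoc, h (t + i) (by omega), add_assoc]
  unfold markInd
  split_ifs <;> tauto

theorem markCount_succ (t : ℕ) (b : ℕ → Bool) (j : ℕ) :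
    markCount t b (j + 1) = markCount t b j + markInd t b j :=
  Finset.sum_range_succ _ _

theorem markCount_mono (t : ℕ) (b : ℕ → Bool) : Monotone (markCount t b) :=
  monotone_nat_of_le_succ fun j => by
    rw [markCount_succ]; linarith [markInd_nonneg t b j]

theorem markCount_add_le (t : ℕ) (b : ℕ → Bool) (j k : ℕ) :
    markCount t b (j + k) ≤ markCount t b j + k := by
  induction k with
  | zero => simp
  | succ k ih =>
    rw [← add_assoc, markCount_succ]
    push_cast
    linarith [markInd_le_one t b (j + k)]

theorem markCount_add_eq {t : ℕ} {b : ℕ → Bool} {j : ℕ} (k : ℕ)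
    (h : ∀ i < k, ¬ MarkerAt t b (j + i)) : markCount t b (j + k) = markCount t b j := by
  induction k with
  | zero => simp
  | succ k ih =>
    rw [← add_assoc, markCount_succ, ih fun i hi => h i (by omega), markInd,
      if_neg (h k (by omega)), add_zero]

theorem markCount_add_le_one {t : ℕ} (ht : 1 ≤ t) (b : ℕ → Bool) (j : ℕ) {k : ℕ}
    (hk : k ≤ 2 * t) : markCount t b (j + k) ≤ markCount t b j + 1 := by
  induction k with
  | zero => simp
  | succ k ih =>
    by_cases hm : MarkerAt t b (j + k)
    · rw [← add_assoc, markCount_succ, markCount_add_eq k]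
      · linarith [markInd_le_one t b (j + k)]
      · intro i hi hmi
        have := hmi.add_le ht hm (by omega)
        omega
    · rw [← add_assoc, markCount_succ, markInd, if_neg hm, add_zero]
      exact ih (by omega)

theorem abs_sum_range_le_of_support (f : ℕ → ℤ) (n : ℕ) (K : ℤ) (S : Finset ℕ)
    (hK : ∀ j, |f j| ≤ K) (hS : ∀ j, j ∉ S → f j = 0) :
    |∑ j ∈ Finset.range n, f j| ≤ K * S.card := by
  have hK0 : 0 ≤ K := (abs_nonneg _).trans (hK 0)
  calc |∑ j ∈ Finset.range n, f j| ≤ ∑ j ∈ Finset.range n, |f j| := Finset.abs_sum_le_sum_abs _ _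
    _ ≤ ∑ j ∈ Finset.range n ∪ S, |f j| :=
        Finset.sum_le_sum_of_subset_of_nonneg Finset.subset_union_left fun _ _ _ => abs_nonneg _
    _ = ∑ j ∈ S, |f j| := (Finset.sum_subset Finset.subset_union_right fun j _ hj => by
        rw [hS j hj, abs_zero]).symm
    _ ≤ ∑ _j ∈ S, K := Finset.sum_le_sum fun j _ => hK j
    _ = K * S.card := by rw [Finset.sum_const, nsmul_eq_mul, mul_comm]

theorem le_sum_range_of_blocks (h : ℕ → ℤ) (hh : ∀ j, 0 ≤ h j) (δ m : ℕ)
    (hb : ∀ i < m, ∃ j, i * δ ≤ j ∧ j < (i + 1) * δ ∧ 1 ≤ h j) :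
    (m : ℤ) ≤ ∑ j ∈ Finset.range (m * δ), h j := by
  induction m with
  | zero => simp
  | succ m ih =>
    obtain ⟨j, hj1, hj2, hj3⟩ := hb m (by omega)
    rw [add_mul, one_mul] at hj2 ⊢
    rw [Finset.sum_range_add]
    have h1 := ih fun i hi => hb i (by omega)
    have h2 : h (m * δ + (j - m * δ)) ≤ ∑ x ∈ Finset.range δ, h (m * δ + x) :=
      Finset.single_le_sum (f := fun x => h (m * δ + x)) (fun _ _ => hh _)
        (Finset.mem_range.2 (by omega))
    rw [Nat.add_sub_cancel' hj1] at h2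
    push_cast
    linarith

/-- The marker counting functions of two words related by a burst shift differ by a bounded
amount; inside the window the difference is `c` minus the number of markers among the last `k`
positions. -/
theorem BurstShift.markCount_sub {t : ℕ} (ht : 1 ≤ t) {b b' : ℕ → Bool} {a L k : ℕ}
    (h : BurstShift b b' a (L + 2 * t) k) (hk : k ≤ t) :
    ∃ c : ℤ,
      (∀ j, j ≤ L → markCount t b (a + j + k) - markCount t b' (a + j) = c) ∧
      (∀ j, |markCount t b j - markCount t b' j| ≤ 6 * t) ∧
      (∀ j, j + 2 * t ≤ a → markCount t b j - markCount t b' j = 0) ∧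
      (∀ j, a + L + 2 * t + k ≤ j → markCount t b j - markCount t b' j =
        markCount t b (a + L + 2 * t + k) - markCount t b' (a + L + 2 * t + k)) := by
  obtain ⟨h1, h2, h3⟩ := h
  have hzero : ∀ j, j + 2 * t ≤ a + 1 → markCount t b j = markCount t b' j := fun j hj =>
    Finset.sum_congr rfl fun i hi => markInd_congr fun l hl =>
      h1 _ (by have := Finset.mem_range.1 hi; omega)
  have hstep : ∀ i j : ℕ, |markCount t b (i + j) - markCount t b' (i + j)| ≤
      |markCount t b i - markCount t b' i| + j := by
    intro i j
    have u1 := markCount_add_le t b i j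
    have u2 := markCount_add_le t b' i j
    have u3 := markCount_mono t b (Nat.le_add_right i j)
    have u4 := markCount_mono t b' (Nat.le_add_right i j)
    have u5 := neg_abs_le (markCount t b i - markCount t b' i)
    have u6 := le_abs_self (markCount t b i - markCount t b' i)
    rw [abs_le]
    constructor <;> linarith
  have hA : ∀ j, j ≤ a → |markCount t b j - markCount t b' j| ≤ 2 * t := by
    intro j hj
    have e1 : markCount t b (j - 2 * t) = markCount t b' (j - 2 * t) := by
      by_cases h : 2 * t ≤ j
      · exact hzero _ (by omega)
      · rw [show j - 2 * t = 0 by omega]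
        rfl
    have e2 := hstep (j - 2 * t) (j - (j - 2 * t))
    rw [Nat.add_sub_cancel' (by omega), e1, sub_self, abs_zero, zero_add] at e2
    exact e2.trans (by exact_mod_cast (show j - (j - 2 * t) ≤ 2 * t by omega))
  have hc : ∀ j, j ≤ L → markCount t b (a + j + k) - markCount t b' (a + j) =
      markCount t b (a + k) - markCount t b' a := by
    intro j
    induction j with
    | zero => simp
    | succ j ih =>
      intro hj
      have e : markInd t b (a + j + k) = markInd t b' (a + j) := markInd_congr fun l hl => by
        rw [show a + j + k + l = a + j + l + k by omega]
        exact h2 _ (by omega) (by omega)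
      rw [show a + (j + 1) + k = a + j + k + 1 by omega, ← add_assoc a j 1, markCount_succ,
        markCount_succ, e, ← ih (by omega)]
      ring
  have hend : ∀ j, markCount t b (a + L + 2 * t + k + j) - markCount t b' (a + L + 2 * t + k + j) =
        markCount t b (a + L + 2 * t + k) - markCount t b' (a + L + 2 * t + k) := by
    intro j
    induction j with
    | zero => simp
    | succ j ih =>
      have e : markInd t b (a + L + 2 * t + k + j) = markInd t b' (a + L + 2 * t + k + j) :=
        markInd_congr fun l hl => h3 _ (by omega)
      rw [← add_assoc, markCount_succ, markCount_succ, e, ← ih]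
      ring
  have hend' : ∀ j, a + L + 2 * t + k ≤ j → markCount t b j - markCount t b' j =
        markCount t b (a + L + 2 * t + k) - markCount t b' (a + L + 2 * t + k) := by
    intro j hj
    obtain ⟨i, rfl⟩ := Nat.exists_eq_add_of_le hj
    exact hend i
  refine ⟨_, hc, ?_, fun j hj => sub_eq_zero.2 (hzero j (by omega)), hend'⟩
  have hkt : (k : ℤ) ≤ t := by exact_mod_cast hk
  have ht' : (1 : ℤ) ≤ t := by exact_mod_cast ht
  have hB : ∀ j, j ≤ k → |markCount t b (a + j) - markCount t b' (a + j)| ≤ 3 * t := by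
    intro j hj
    have : (j : ℤ) ≤ k := by exact_mod_cast hj
    linarith [hstep a j, hA a le_rfl]
  have hc3 : |markCount t b (a + k) - markCount t b' a| ≤ 3 * t := by
    have u1 := abs_le.1 (hB k le_rfl)
    have u2 := abs_le.1 (hA a le_rfl)
    have u3 := markCount_mono t b (Nat.le_add_right a k)
    have u4 := markCount_mono t b' (Nat.le_add_right a k)
    have u5 := markCount_add_le t b a k
    rw [abs_le]
    constructor <;> linarith [u1.1, u1.2, u2.1, u2.2]
  have hC : ∀ j, j ≤ L → |markCount t b (a + j + k) - markCount t b' (a + j + k)| ≤ 4 * t := by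
    intro j hj
    have u1 := markCount_mono t b' (Nat.le_add_right (a + j) k)
    have u2 := markCount_add_le t b' (a + j) k
    have u3 := abs_le.1 hc3
    rw [abs_le]
    constructor <;> linarith [u3.1, u3.2, hc j hj]
  have hD : ∀ j, j ≤ 2 * t →
      |markCount t b (a + L + k + j) - markCount t b' (a + L + k + j)| ≤ 6 * t := by
    intro j hj
    have : (j : ℤ) ≤ 2 * t := by exact_mod_cast hj
    linarith [hstep (a + L + k) j, hC L le_rfl]
  intro j
  by_cases c1 : j ≤ a
  · linarith [hA j c1]
  by_cases c2 : j ≤ a + k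
  · have := hB (j - a) (by omega)
    rw [Nat.add_sub_cancel' (by omega)] at this
    linarith
  by_cases c3 : j ≤ a + L + k
  · have := hC (j - a - k) (by omega)
    rw [show a + (j - a - k) + k = j by omega] at this
    linarith
  by_cases c4 : j ≤ a + L + 2 * t + k
  · have := hD (j - (a + L + k)) (by omega)
    rwa [Nat.add_sub_cancel' (by omega)] at this
  · rw [hend' j (by omega), show a + L + 2 * t + k = a + L + k + 2 * t by omega]
    exact hD _ le_rfl

/-- If the marker count and the sum of the marker counting function agree modulo suitable numbers
and markers are dense, then the window of a burst shift is short. -/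
theorem BurstShift.window_lt {t : ℕ} (ht : 1 ≤ t) {b b' : ℕ → Bool} {a L k n δ : ℕ}
    (h : BurstShift b b' a L k) (hk : k ≤ t) (hk1 : 1 ≤ k) (hn : a + L + k ≤ n)
    (hdense : ∀ i, i + δ ≤ n → ∃ j, i ≤ j ∧ j + 2 * t ≤ i + δ ∧ MarkerAt t b' j)
    (hcount : (markCount t b n : ZMod (6 * t + 1)) = (markCount t b' n : ZMod (6 * t + 1)))
    (hsum : ((∑ j ∈ Finset.range n, markCount t b j : ℤ) : ZMod (6 * t * n + 1)) =
      ((∑ j ∈ Finset.range n, markCount t b' j : ℤ) : ZMod (6 * t * n + 1))) :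
    L < (30 * t ^ 2 + 1) * δ + 2 * t := by
  by_contra hL
  obtain ⟨L, rfl⟩ : ∃ L', L = L' + 2 * t := ⟨L - 2 * t, by omega⟩
  have hL' : (30 * t ^ 2 + 1) * δ ≤ L := by omega
  obtain ⟨c, hc, hK, hbef, haft⟩ := h.markCount_sub ht hk
  set d : ℕ → ℤ := fun j => markCount t b j - markCount t b' j with hd
  have hdn : d n = 0 := by
    have h1 := (ZMod.intCast_eq_intCast_iff_dvd_sub _ _ _).1 hcount
    rw [← neg_sub, dvd_neg] at h1
    refine Int.eq_zero_of_abs_lt_dvd h1 ((hK n).trans_lt ?_)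
    push_cast
    linarith
  have hafter : ∀ j, a + L + 2 * t + k ≤ j → d j = 0 := fun j hj =>
    (haft j hj).trans ((haft n (by omega)).symm.trans hdn)
  have hD : ∑ j ∈ Finset.range n, d j = 0 := by
    have h1 := (ZMod.intCast_eq_intCast_iff_dvd_sub _ _ _).1 hsum
    rw [← neg_sub, dvd_neg, ← Finset.sum_sub_distrib] at h1
    refine Int.eq_zero_of_abs_lt_dvd h1 ?_
    calc |∑ j ∈ Finset.range n, d j| ≤ ∑ j ∈ Finset.range n, |d j| :=
          Finset.abs_sum_le_sum_abs _ _
      _ ≤ ∑ _j ∈ Finset.range n, (6 * t : ℤ) := Finset.sum_le_sum fun j _ => hK j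
      _ < _ := by
        rw [Finset.sum_const, Finset.card_range, nsmul_eq_mul]
        push_cast
        linarith [mul_comm (n : ℤ) (6 * t)]
  set m := 30 * t ^ 2 + 1 with hm
  let w : ℕ → ℤ := fun j => if a + k ≤ j ∧ j < a + k + L then d j else 0
  have hw : ∑ j ∈ Finset.range n, w j = ∑ i ∈ Finset.range L, d (a + k + i) := by
    obtain ⟨r, rfl⟩ := Nat.exists_eq_add_of_le (show a + k + L ≤ n by omega)
    rw [add_assoc (a + k), Finset.sum_range_add _ (a + k), Finset.sum_range_add _ L]
    have e1 : ∑ j ∈ Finset.range (a + k), w j = 0 := Finset.sum_eq_zero fun j hj =>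
      if_neg (by have := Finset.mem_range.1 hj; omega)
    have e2 : ∑ j ∈ Finset.range r, w (a + k + (L + j)) = 0 :=
      Finset.sum_eq_zero fun j hj => if_neg (by omega)
    rw [e1, e2, zero_add, add_zero]
    exact Finset.sum_congr rfl fun j hj => if_pos (by have := Finset.mem_range.1 hj; omega)
  have hdw : |∑ j ∈ Finset.range n, (d j - w j)| ≤ 6 * t *
      (Finset.Ico (a - 2 * t) (a + k) ∪
        Finset.Ico (a + k + L) (a + k + L + 2 * t)).card := by
    refine abs_sum_range_le_of_support _ _ _ _ (fun j => ?_) fun j hj => ?_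
    · simp only [w]
      split_ifs
      · rw [sub_self, abs_zero]
        positivity
      · rw [sub_zero]
        exact hK j
    · simp only [Finset.mem_union, Finset.mem_Ico, not_or] at hj
      simp only [w]
      split_ifs
      · exact sub_self _
      · rw [sub_zero]
        by_cases hja : j + 2 * t ≤ a
        · exact hbef j hja
        · exact hafter j (by omega)
  have hcard : ((Finset.Ico (a - 2 * t) (a + k) ∪
        Finset.Ico (a + k + L) (a + k + L + 2 * t)).card : ℤ) ≤ 5 * t := by
    refine (Int.ofNat_le.2 (Finset.card_union_le _ _)).trans ?_
    rw [Nat.card_Ico, Nat.card_Ico]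
    omega
  rw [Finset.sum_sub_distrib, hD, zero_sub, abs_neg, hw] at hdw
  have hupper : |∑ i ∈ Finset.range L, d (a + k + i)| ≤ 30 * t ^ 2 :=
    hdw.trans (by nlinarith)
  have hlower : ∀ g : ℕ → ℤ, (∀ i, i < L → 0 ≤ g i) →
      (∀ i, i + 2 * t ≤ L → MarkerAt t b' (a + i) → 1 ≤ g i ∨ 1 ≤ g (i + 1)) →
      (m : ℤ) ≤ ∑ i ∈ Finset.range L, g i := by
    intro g hg0 hg1
    have e : ∑ i ∈ Finset.range (m * δ), max (g i) 0 ≤ ∑ i ∈ Finset.range L, g i := by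
      rw [← Finset.sum_congr rfl fun i hi => max_eq_left (hg0 i (Finset.mem_range.1 hi))]
      exact Finset.sum_le_sum_of_subset_of_nonneg (Finset.range_mono hL')
        fun _ _ _ => le_max_right _ _
    refine (le_sum_range_of_blocks _ (fun _ => le_max_right _ _) δ m fun i hi => ?_).trans e
    have hiδ : (i + 1) * δ ≤ m * δ := Nat.mul_le_mul_right _ hi
    rw [add_mul, one_mul] at hiδ ⊢
    obtain ⟨j, hj1, hj2, hj3⟩ := hdense (a + i * δ) (by omega)
    obtain ⟨j, rfl⟩ := Nat.exists_eq_add_of_le (show a ≤ j by omega)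
    rcases hg1 j (by omega) hj3 with hj | hj
    · exact ⟨j, by omega, by omega, le_max_of_le_left hj⟩
    · exact ⟨j + 1, by omega, by omega, le_max_of_le_left hj⟩
  have hdc : ∀ i, i ≤ L →
      d (a + k + i) = c - (markCount t b' (a + i + k) - markCount t b' (a + i)) := by
    intro i hi
    rw [← hc i hi, hd, show a + k + i = a + i + k by omega]
    ring
  have hupper' := abs_le.1 hupper
  rcases le_or_gt c 0 with hc0 | hc0
  · have h1 := hlower (fun i => -d (a + k + i)) (fun i hi => by
      have := markCount_mono t b' (Nat.le_add_right (a + i) k)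
      simp only [hdc i hi.le]
      linarith) (fun i hi hmark => Or.inl (by
      have h2 := markCount_mono t b' (show a + i + 1 ≤ a + i + k by omega)
      rw [markCount_succ, markInd, if_pos hmark] at h2
      simp only [hdc i (by omega)]
      linarith))
    rw [Finset.sum_neg_distrib] at h1
    push_cast [hm] at h1
    linarith [hupper'.1]
  · have h1 := hlower (fun i => d (a + k + i)) (fun i hi => by
      have := markCount_add_le_one ht b' (a + i) (show k ≤ 2 * t by omega)
      simp only [hdc i hi.le]
      linarith) (fun i hi hmark => Or.inr (by
      have h2 : markCount t b' (a + (i + 1) + k) = markCount t b' (a + (i + 1)) :=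
        markCount_add_eq k fun l hl hml => by
          have := hmark.add_le ht hml (by omega)
          omega
      simp only [hdc (i + 1) (by omega)]
      linarith))
    push_cast [hm] at h1
    linarith [hupper'.2]

end Marker

section Lists

theorem burstShift_getD {α : Type*} (z : α) (u v s v' w : List α) (hv : v.length = v'.length) :
    BurstShift (fun i => (u ++ v ++ (s ++ w)).getD i z) (fun i => (u ++ s ++ v' ++ w).getD i z)
      u.length s.length v.length := by
  simp only [List.getD_eq_getElem?_getD]
  refine ⟨fun i hi => ?_, fun i hi hi' => ?_, fun i hi => ?_⟩
  · grind
  · grind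
  · rw [List.append_assoc, List.getElem?_append_right (by omega),
      List.getElem?_append_right (by omega), List.getElem?_append_right (by omega),
      List.getElem?_append_right (by simp only [List.length_append]; omega)]
    simp only [List.length_append]
    congr 2
    omega

theorem DenseStr.exists_markerAt {t δ : ℕ} {c : List Bool} (h : DenseStr (pat t) δ c) {i : ℕ}
    (hi : i + δ ≤ c.length) :
    ∃ j, i ≤ j ∧ j + 2 * t ≤ i + δ ∧ MarkerAt t (fun l => c.getD l false) j := by
  have hlen : ((c.drop i).take δ).length = δ := by
    rw [List.length_take, List.length_drop]
    omega
  obtain ⟨p, s, hps⟩ := h ((c.drop i).take δ)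
    ((List.take_prefix _ _).isInfix.trans (List.drop_suffix _ _).isInfix) hlen
  have hplen := congrArg List.length hps
  simp only [pat, List.length_append, List.length_replicate, hlen] at hplen
  refine ⟨i + p.length, by omega, by omega, fun l hl => ?_⟩
  have hget : ∀ r, r < δ → c.getD (i + r) false = (p ++ pat t ++ s).getD r false := by
    intro r hr
    rw [hps]
    simp only [List.getD_eq_getElem?_getD, List.getElem?_take, List.getElem?_drop, if_pos hr]
  beta_reduce
  rw [add_assoc, add_assoc, add_assoc, hget _ (by omega), hget _ (by omega)]
  simp only [List.getD_eq_getElem?_getD, pat]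
  constructor
  · grind
  · grind

/-- The word underlying a list, padded by `z`. -/
def toWord {α : Type*} (z : α) (x : List α) : ℕ → α := fun i => x.getD i z

/-- The marker count and the sum of the marker counting function of the least-significant-bit
string, modulo suitable numbers. -/
noncomputable def locator {q : ℕ} (t n : ℕ) (x : List (Fin q)) :
    ZMod (6 * t + 1) × ZMod (6 * t * n + 1) :=
  ((markCount t (fun i => (lsb x).getD i false) n : ℤ),
    (∑ j ∈ Finset.range n, markCount t (fun i => (lsb x).getD i false) j : ℤ))

/-- The sums of the block colours over the two tilings with offsets `0` and `R`. -/
def blockSums {α A : Type*} [AddCommGroup A] (z : α) (R n : ℕ) (c : (Fin (2 * R) → α) → A)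
    (x : List α) : A × A :=
  (∑ i ∈ Finset.range (n + 1), c (block (2 * R) (i * (2 * R)) (toWord z x)),
    ∑ i ∈ Finset.range (n + 1), c (block (2 * R) (i * (2 * R) + R) (toWord z x)))

theorem eq_of_locator_eq_of_blockSums_eq {q t n δ R : ℕ} {A : Type*} [AddCommGroup A]
    (ht : 1 ≤ t) (hR : (30 * t ^ 2 + 1) * δ + 3 * t ≤ R) (z : Fin q)
    (hz : (z : ℕ) = 0) (c : (Fin (2 * R) → Fin q) → A)
    (hc : ∀ y y' : Fin (2 * R) → Fin q, (∃ a L k, a + L + k ≤ 2 * R ∧ k ≤ t ∧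
      BurstShift (padWord z y) (padWord z y') a L k) → c y = c y' → y = y')
    {x x' : List (Fin q)} (hx : x.length = n) (hx' : x'.length = n)
    (hd : DenseStr (pat t) δ (lsb x)) (hd' : DenseStr (pat t) δ (lsb x'))
    (hloc : locator t n x = locator t n x')
    (hsum : blockSums z R n c x = blockSums z R n c x')
    (hB : (Bset t x ∩ Bset t x').Nonempty) : x = x' := by
  obtain ⟨y, ⟨u, v, w, hxe, hy, hv⟩, u', v', w', hxe', hy', hv'⟩ := hB
  wlog huu : u.length ≤ u'.length generalizing x x' u v w u' v' w'
  · exact (this hx' hx hd' hd hloc.symm hsum.symm u' v' w' hxe' hy' hv' u v w hxe hy hv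
      (by omega)).symm
  have hvv : v.length = v'.length := by
    have e1 := congrArg List.length hxe
    have e2 := congrArg List.length hxe'
    have e3 := congrArg List.length (hy.symm.trans hy')
    simp only [List.length_append] at e1 e2 e3
    omega
  obtain ⟨s, rfl, rfl⟩ : ∃ s, u' = u ++ s ∧ w = s ++ w' := by
    obtain ⟨s, hs⟩ := List.prefix_of_prefix_length_le (List.prefix_append u w)
      ((hy.symm.trans hy') ▸ List.prefix_append u' w') huu
    subst hs
    refine ⟨s, rfl, ?_⟩
    have := hy.symm.trans hy'
    rwa [List.append_assoc, List.append_cancel_left_eq] at this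
  have hshift : BurstShift (toWord z x) (toWord z x') u.length s.length v.length := by
    rw [hxe, hxe']
    exact burstShift_getD z u v s v' w' hvv
  rcases Nat.eq_zero_or_pos v.length with hv0 | hv0
  · have hv1 : v = [] := List.length_eq_zero_iff.1 hv0
    have hv2 : v' = [] := List.length_eq_zero_iff.1 (hvv.symm.trans hv0)
    simp [hxe, hxe', hv1, hv2]
  have hxlen : u.length + s.length + v.length ≤ n := by
    rw [← hx, hxe]
    simp only [List.length_append]
    omega
  have hlsb : ∀ x : List (Fin q), (fun i => (lsb x).getD i false) =
      fun i => (fun a : Fin q => decide (a.val % 2 = 1)) (toWord z x i) := by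
    intro x
    funext i
    have h : (lsb x).getD i (decide ((z : ℕ) % 2 = 1)) = decide ((x.getD i z : ℕ) % 2 = 1) :=
      List.getD_map x z fun a : Fin q => decide (a.val % 2 = 1)
    rwa [show decide ((z : ℕ) % 2 = 1) = false by simp [hz]] at h
  have hshift' : BurstShift (fun i => (lsb x).getD i false) (fun i => (lsb x').getD i false)
      u.length s.length v.length := by
    rw [hlsb, hlsb]
    exact hshift.comp fun a : Fin q => decide (a.val % 2 = 1)
  have hL := hshift'.window_lt ht hv hv0 hxlen
    (fun i hi => hd'.exists_markerAt (by rwa [lsb, List.length_map, hx']))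
    (congrArg Prod.fst hloc) (congrArg Prod.snd hloc)
  have hX := hshift.eq_of_block_sums z (show s.length + v.length ≤ R by omega) (by omega) hv
    (by omega) c hc (congrArg Prod.fst hsum) (congrArg Prod.snd hsum)
  refine List.ext_getElem (hx.trans hx'.symm) fun i h1 h2 => ?_
  have := congrFun hX i
  simpa only [toWord, List.getD_eq_getElem _ _ h1, List.getD_eq_getElem _ _ h2] using this

end Lists

section Size

theorem clog_le_two_mul_logb {n : ℕ} (hn : 4 ≤ n) : (Nat.clog 2 n : ℝ) ≤ 2 * Real.logb 2 n := by
  have h1 : (1 : ℝ) ≤ Real.logb 2 n := by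
    rw [Real.le_logb_iff_rpow_le (by norm_num) (by positivity), Real.rpow_one]
    exact_mod_cast (show 2 ≤ n by omega)
  have h2 := Nat.ceil_lt_add_one (show 0 ≤ Real.logb 2 n by linarith)
  have h3 := Real.natCeil_logb_natCast 2 n
  push_cast at h3
  rw [h3] at h2
  linarith

theorem clog_le_logb_add_one {T : ℕ} (hT : 2 ≤ T) : (Nat.clog 2 T : ℝ) ≤ Real.logb 2 T + 1 := by
  have h2 := Nat.ceil_lt_add_one (show 0 ≤ Real.logb 2 T from
    Real.logb_nonneg (by norm_num) (by exact_mod_cast (show 1 ≤ T by omega)))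
  have h3 := Real.natCeil_logb_natCast 2 T
  push_cast at h3
  rw [h3] at h2
  exact h2.le

theorem clog_le_of_le_mul {n T C : ℕ} (hn : 4 ≤ n) (hT : 2 ≤ T) (hC : 1 ≤ C)
    (h : T ≤ C * n * Nat.clog 2 n ^ 4) :
    (Nat.clog 2 T : ℝ) ≤ Real.logb 2 n + 4 * Real.logb 2 (Real.logb 2 n) +
      (Real.logb 2 C + 5) := by
  have hl : 0 < Nat.clog 2 n := Nat.clog_pos (by norm_num) (by omega)
  have hlR : (0 : ℝ) < Nat.clog 2 n := by exact_mod_cast hl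
  have hCR : (0 : ℝ) < C := by exact_mod_cast hC
  have hnR : (0 : ℝ) < n := by exact_mod_cast (show 0 < n by omega)
  have hTR : (0 : ℝ) < T := by exact_mod_cast (show 0 < T by omega)
  have hclog := clog_le_two_mul_logb hn
  have hlog : 0 < Real.logb 2 n := by linarith
  have h1 : Real.logb 2 T ≤ Real.logb 2 (C * n * (Nat.clog 2 n) ^ 4) :=
    Real.logb_le_logb_of_le (by norm_num) hTR (by exact_mod_cast h)
  rw [Real.logb_mul (by positivity) (by positivity), Real.logb_mul hCR.ne' hnR.ne',
    Real.logb_pow] at h1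
  have h2 : Real.logb 2 (Nat.clog 2 n) ≤ Real.logb 2 (2 * Real.logb 2 n) :=
    Real.logb_le_logb_of_le (by norm_num) hlR hclog
  rw [Real.logb_mul (by norm_num) hlog.ne', Real.logb_self_eq_one (by norm_num)] at h2
  have h3 := clog_le_logb_add_one hT
  push_cast at h1
  linarith

end Size

theorem stmt_4 (q t : ℕ) (hq : 2 ≤ q) (hqeven : Even q) (ht : 1 ≤ t)
    (ε : ℝ) (hε : 0 < ε) :
    ∃ γ : ℝ, ∃ n₀ : ℕ, ∀ n : ℕ, n₀ ≤ n →
      ∃ m : ℕ, 0 < m ∧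
        (m : ℝ) ≤ Real.logb 2 n +
          (8 + ε) * (Real.logb 2 q + 1) * Real.logb 2 (Real.logb 2 n) + γ ∧
        ∃ f : List (Fin q) → (Fin m → Bool),
          ∀ x x' : List (Fin q), x.length = n → x'.length = n →
            DenseStr (pat t) (t * 2 ^ (t + 1) * Nat.clog 2 n) (lsb x) →
            DenseStr (pat t) (t * 2 ^ (t + 1) * Nat.clog 2 n) (lsb x') →
            f x = f x' → (Bset t x ∩ Bset t x').Nonempty → x = x' := by
  set B := (30 * t ^ 2 + 1) * (t * 2 ^ (t + 1)) + 3 * t with hB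
  set D := 2 * ((2 * B + 1) * (2 * B + 1) * (t + 1) * q ^ t) + 1 with hD
  set C := (6 * t + 1) * (6 * t + 1) * (D * D) with hC
  refine ⟨Real.logb 2 C + 5, 4, fun n hn => ?_⟩
  set ℓ := Nat.clog 2 n with hℓ
  have hℓ1 : 1 ≤ ℓ := Nat.clog_pos (by norm_num) (by omega)
  set δ := t * 2 ^ (t + 1) * ℓ with hδ
  set R := B * ℓ with hR
  have hRδ : (30 * t ^ 2 + 1) * δ + 3 * t ≤ R := by
    have h1 : 3 * t * 1 ≤ 3 * t * ℓ := Nat.mul_le_mul_left _ hℓ1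
    calc (30 * t ^ 2 + 1) * δ + 3 * t ≤ (30 * t ^ 2 + 1) * δ + 3 * t * ℓ := by omega
      _ = R := by rw [hR, hB, hδ]; ring
  let z : Fin q := ⟨0, by omega⟩
  obtain ⟨N, hN, c, hc⟩ := exists_burst_coloring z t (2 * R)
  have : NeZero N := ⟨by omega⟩
  have hND : N ≤ D * ℓ ^ 2 := by
    have h1 : 2 * R + 1 ≤ (2 * B + 1) * ℓ := by rw [hR]; nlinarith
    have h2 : 1 ≤ ℓ ^ 2 := Nat.one_le_pow _ _ hℓ1
    calc N ≤ 2 * (((2 * B + 1) * ℓ) * ((2 * B + 1) * ℓ) * (t + 1) * q ^ t) + ℓ ^ 2 := by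
          rw [hN, Fintype.card_fin]
          gcongr
      _ = D * ℓ ^ 2 := by rw [hD]; ring
  have hcard : Fintype.card ((ZMod (6 * t + 1) × ZMod (6 * t * n + 1)) × (ZMod N × ZMod N)) =
      (6 * t + 1) * (6 * t * n + 1) * (N * N) := by
    simp only [Fintype.card_prod, ZMod.card]
  have hN1 : 1 ≤ N := by omega
  have hT2 : 2 ≤ (6 * t + 1) * (6 * t * n + 1) * (N * N) :=
    calc 2 ≤ (6 * t + 1) * 1 * (1 * 1) := by omega
      _ ≤ _ := by gcongr; omega
  have hTC : (6 * t + 1) * (6 * t * n + 1) * (N * N) ≤ C * n * ℓ ^ 4 :=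
    calc (6 * t + 1) * (6 * t * n + 1) * (N * N)
        ≤ (6 * t + 1) * (6 * t * n + n) * ((D * ℓ ^ 2) * (D * ℓ ^ 2)) := by
          gcongr
          omega
      _ = C * n * ℓ ^ 4 := by rw [hC]; ring
  have hC1 : 1 ≤ C := by rw [hC, hD]; exact Nat.succ_le_of_lt (by positivity)
  refine ⟨Nat.clog 2 ((6 * t + 1) * (6 * t * n + 1) * (N * N)),
    Nat.clog_pos (by norm_num) hT2, ?_, ?_⟩
  · have h1 := clog_le_of_le_mul hn hT2 hC1 hTC
    have hlogq : 0 ≤ Real.logb 2 q :=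
      Real.logb_nonneg (by norm_num) (by exact_mod_cast (show 1 ≤ q by omega))
    have hlogn : 1 ≤ Real.logb 2 n := by
      rw [Real.le_logb_iff_rpow_le (by norm_num) (by positivity), Real.rpow_one]
      exact_mod_cast (show 2 ≤ n by omega)
    have hloglog : 0 ≤ Real.logb 2 (Real.logb 2 n) := Real.logb_nonneg (by norm_num) hlogn
    have h2 : 4 * Real.logb 2 (Real.logb 2 n) ≤
        (8 + ε) * (Real.logb 2 q + 1) * Real.logb 2 (Real.logb 2 n) :=
      mul_le_mul_of_nonneg_right (by nlinarith) hloglog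
    linarith
  · obtain ⟨e⟩ := Function.Embedding.nonempty_of_card_le
      (α := (ZMod (6 * t + 1) × ZMod (6 * t * n + 1)) × (ZMod N × ZMod N))
      (β := Fin (Nat.clog 2 ((6 * t + 1) * (6 * t * n + 1) * (N * N))) → Bool) (by
        rw [hcard, Fintype.card_fun, Fintype.card_bool, Fintype.card_fin]
        exact Nat.le_pow_clog (by norm_num) _)
    refine ⟨fun x => e (locator t n x, blockSums z R n c x), fun x x' hx hx' hd hd' hf hB => ?_⟩
    have hinj := e.injective hf
    exact eq_of_locator_eq_of_blockSums_eq ht hRδ z rfl c hc hx hx' hd hd'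
      (congrArg Prod.fst hinj) (congrArg Prod.snd hinj) hB
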